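/- Let 0 < ξ ≤ 1/4 and define t_1 = (−1+√(1+4ξ))/(2ξ), t_2 = (1−√(1−4ξ))/(2ξ), t_3 = ξ^{−1/2}, t_4 = (1+√(1−4ξ))/(2ξ), t_5 = (1+√(1+4ξ))/(2ξ). Then for all t ∈ ℝ: ω_2(ξ,t) = 1 + 4ξ²t² if |t| ≤ t_1; ω_2(ξ,t) = 1/(2t²) + 1/2 + ξ(1−2|t|) + (5/2)ξ²t² if t_1 < |t| ≤ t_2; ω_2(ξ,t) = 1/t² + ξ²t² if t_2 < |t| ≤ t_3; ω_2(ξ,t) = 2ξ if t_3 < |t| ≤ t_4; ω_2(ξ,t) = 1/(2t²) − 1/2 + ξ(1+2|t|) − (3/2)ξ²t² if t_4 < |t| ≤ t_5; and ω_2(ξ,t) = 0 if |t| > t_5. -/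

import Mathlib

open MeasureTheory

/-- The domain `D_2(ξ,t) ⊆ ℝ`: real numbers `p_1` with `|p_1| ≤ 1` and `|ξ t² + p_1 t| ≤ 1`. -/
def Dset2 (ξ t : ℝ) : Set ℝ := {p | |p| ≤ 1 ∧ |ξ * t ^ 2 + p * t| ≤ 1}

/-- The density function `ω_2(ξ,t)` of real quadratic algebraic integers. -/
noncomputable def omega2 (ξ t : ℝ) : ℝ := ∫ p in Dset2 ξ t, |2 * ξ * t + p|


lemma aux_int_cross (c a b : ℝ) (h1 : a ≤ -c) (h2 : -c ≤ b) :
    ∫ p in Set.Icc a b, |c + p| = ((c + b) ^ 2 + (c + a) ^ 2) / 2 := by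
  rw [integral_Icc_eq_integral_Ioc, ← intervalIntegral.integral_of_le (h1.trans h2)]
  have hc : Continuous fun p : ℝ => |c + p| := by fun_prop
  rw [← intervalIntegral.integral_add_adjacent_intervals (b := -c)
    (hc.intervalIntegrable _ _) (hc.intervalIntegrable _ _)]
  have e1 : ∫ p in a..(-c), |c + p| = ∫ p in a..(-c), (-c - p) := by
    apply intervalIntegral.integral_congr
    intro p hp
    rw [Set.uIcc_of_le h1] at hp
    simp only
    rw [abs_of_nonpos (by linarith [hp.2])]; ring
  have e2 : ∫ p in (-c)..b, |c + p| = ∫ p in (-c)..b, (c + p) := by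
    apply intervalIntegral.integral_congr
    intro p hp
    rw [Set.uIcc_of_le h2] at hp
    simp only
    rw [abs_of_nonneg (by linarith [hp.1])]
  rw [e1, e2, intervalIntegral.integral_sub (by simp) (by simp),
    intervalIntegral.integral_add (by simp) (by simp)]
  simp
  ring

lemma aux_int_pos (c a b : ℝ) (h1 : -c ≤ a) (h2 : a ≤ b) :
    ∫ p in Set.Icc a b, |c + p| = ((c + b) ^ 2 - (c + a) ^ 2) / 2 := by
  rw [integral_Icc_eq_integral_Ioc, ← intervalIntegral.integral_of_le h2]
  have e2 : ∫ p in a..b, |c + p| = ∫ p in a..b, (c + p) := by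
    apply intervalIntegral.integral_congr
    intro p hp
    rw [Set.uIcc_of_le h2] at hp
    simp only
    rw [abs_of_nonneg (by linarith [hp.1])]
  rw [e2, intervalIntegral.integral_add (by simp) (by simp)]
  simp
  ring

lemma aux_neg (ξ t : ℝ) : omega2 ξ (-t) = omega2 ξ t := by
  have h : ∀ s, MeasurableSet (Dset2 ξ s) := by
    intro s
    apply IsClosed.measurableSet
    have c1 : IsClosed {p : ℝ | |p| ≤ 1} := isClosed_le (by fun_prop) (by fun_prop)
    have c2 : IsClosed {p : ℝ | |ξ * s ^ 2 + p * s| ≤ 1} := isClosed_le (by fun_prop) (by fun_prop)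
    exact c1.inter c2
  unfold omega2
  rw [← integral_indicator (h _), ← integral_indicator (h _),
    ← integral_neg_eq_self]
  congr 1
  ext p
  have e : -p ∈ Dset2 ξ (-t) ↔ p ∈ Dset2 ξ t := by
    simp [Dset2]
  have e' : |2 * ξ * -t + -p| = |2 * ξ * t + p| := by
    rw [← abs_neg]; congr 1; ring
  by_cases hp : p ∈ Dset2 ξ t
  · rw [Set.indicator_of_mem hp, Set.indicator_of_mem (e.2 hp), e']
  · rw [Set.indicator_of_notMem hp, Set.indicator_of_notMem (fun h => hp (e.1 h))]

lemma aux_abs (ξ t : ℝ) : omega2 ξ |t| = omega2 ξ t := by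
  rcases abs_choice t with h | h <;> rw [h]
  exact aux_neg ξ t

lemma aux_D (ξ s : ℝ) (hs : 0 < s) :
    Dset2 ξ s = Set.Icc (max (-1) (-(1 / s) - ξ * s)) (min 1 (1 / s - ξ * s)) := by
  ext p
  have e1 : -(1 / s) - ξ * s ≤ p ↔ -1 ≤ ξ * s ^ 2 + p * s := by
    rw [← mul_le_mul_iff_left₀ hs]
    have : (-(1 / s) - ξ * s) * s = -1 - ξ * s ^ 2 := by field_simp
    rw [this]
    constructor <;> intro h <;> linarith
  have e2 : p ≤ 1 / s - ξ * s ↔ ξ * s ^ 2 + p * s ≤ 1 := by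
    rw [← mul_le_mul_iff_left₀ hs]
    have : (1 / s - ξ * s) * s = 1 - ξ * s ^ 2 := by field_simp
    rw [this]
    constructor <;> intro h <;> linarith
  simp only [Dset2, Set.mem_ofPred_eq, Set.mem_Icc, abs_le, max_le_iff, le_min_iff, e1, e2]
  tauto

lemma aux_lo (ξ s : ℝ) (hs : 0 < s) : -(1 / s) - ξ * s ≤ -1 ↔ 0 ≤ ξ * s ^ 2 - s + 1 := by
  rw [← mul_le_mul_iff_left₀ hs]
  have : (-(1 / s) - ξ * s) * s = -1 - ξ * s ^ 2 := by field_simp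
  rw [this]
  constructor <;> intro h <;> linarith

lemma aux_hi (ξ s : ℝ) (hs : 0 < s) (x : ℝ) : 1 / s - ξ * s ≤ x ↔ 1 ≤ ξ * s ^ 2 + x * s := by
  rw [← mul_le_mul_iff_left₀ hs]
  have : (1 / s - ξ * s) * s = 1 - ξ * s ^ 2 := by field_simp
  rw [this]
  constructor <;> intro h <;> linarith

set_option maxHeartbeats 4000000 in
theorem omega2_formula (ξ : ℝ) (hξ0 : 0 < ξ) (hξ : ξ ≤ 1 / 4) (t : ℝ) :
    (|t| ≤ (-1 + Real.sqrt (1 + 4 * ξ)) / (2 * ξ) →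
      omega2 ξ t = 1 + 4 * ξ ^ 2 * t ^ 2) ∧
    ((-1 + Real.sqrt (1 + 4 * ξ)) / (2 * ξ) < |t| →
      |t| ≤ (1 - Real.sqrt (1 - 4 * ξ)) / (2 * ξ) →
      omega2 ξ t = 1 / (2 * t ^ 2) + 1 / 2 + ξ * (1 - 2 * |t|) + (5 / 2) * ξ ^ 2 * t ^ 2) ∧
    ((1 - Real.sqrt (1 - 4 * ξ)) / (2 * ξ) < |t| → |t| ≤ 1 / Real.sqrt ξ →
      omega2 ξ t = 1 / t ^ 2 + ξ ^ 2 * t ^ 2) ∧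
    (1 / Real.sqrt ξ < |t| → |t| ≤ (1 + Real.sqrt (1 - 4 * ξ)) / (2 * ξ) →
      omega2 ξ t = 2 * ξ) ∧
    ((1 + Real.sqrt (1 - 4 * ξ)) / (2 * ξ) < |t| →
      |t| ≤ (1 + Real.sqrt (1 + 4 * ξ)) / (2 * ξ) →
      omega2 ξ t = 1 / (2 * t ^ 2) - 1 / 2 + ξ * (1 + 2 * |t|) - (3 / 2) * ξ ^ 2 * t ^ 2) ∧
    ((1 + Real.sqrt (1 + 4 * ξ)) / (2 * ξ) < |t| → omega2 ξ t = 0) := by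
  rw [← aux_abs ξ t, ← sq_abs t]
  have hs0 : 0 ≤ |t| := abs_nonneg t
  generalize |t| = s at *
  have hr1 := Real.sqrt_nonneg (1 + 4 * ξ)
  have hr2 := Real.sq_sqrt (show 0 ≤ 1 + 4 * ξ by linarith)
  have hq1 := Real.sqrt_nonneg (1 - 4 * ξ)
  have hq2 := Real.sq_sqrt (show 0 ≤ 1 - 4 * ξ by linarith)
  have hu1 := Real.sqrt_pos.2 hξ0
  have hu2 := Real.sq_sqrt hξ0.le
  generalize Real.sqrt (1 + 4 * ξ) = r at *
  generalize Real.sqrt (1 - 4 * ξ) = q at *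
  generalize Real.sqrt ξ = u at *
  have h2ξ : 0 < 2 * ξ := by linarith
  simp only [le_div_iff₀ h2ξ, div_lt_iff₀ h2ξ, le_div_iff₀ hu1, div_lt_iff₀ hu1]
  have hr3 : 1 ≤ r := by nlinarith
  have hq3 : q ≤ 1 := by nlinarith
  have hid1 : ξ * (ξ * s ^ 2 + s - 1) * 4 = (s * (2 * ξ) + 1) ^ 2 - r ^ 2 := by rw [hr2]; ring
  have hid2 : ξ * (ξ * s ^ 2 - s + 1) * 4 = (s * (2 * ξ) - 1) ^ 2 - q ^ 2 := by rw [hq2]; ring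
  have hid3 : ξ * (ξ * s ^ 2 - s - 1) * 4 = (s * (2 * ξ) - 1) ^ 2 - r ^ 2 := by rw [hr2]; ring
  have hid4 : ξ * s ^ 2 = (s * u) ^ 2 := by rw [mul_pow, hu2]; ring
  have hsx : 0 ≤ s * (2 * ξ) := by positivity
  have key : ∀ x : ℝ, 0 ≤ ξ * x * 4 → 0 ≤ x := by
    intro x hx
    by_contra hh
    push Not at hh
    linarith [mul_neg_of_pos_of_neg hξ0 hh]
  have key' : ∀ x : ℝ, ξ * x * 4 ≤ 0 → x ≤ 0 := by
    intro x hx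
    by_contra hh
    push Not at hh
    linarith [mul_pos hξ0 hh]
  have hqr : q ≤ r := by linarith
  -- s beyond t_1
  have hbig : r - 1 < s * (2 * ξ) → 0 < s ∧ 0 ≤ ξ * s ^ 2 + s - 1 := by
    intro h
    refine ⟨by by_contra hh; rw [le_antisymm (not_lt.1 hh) hs0] at h; linarith, key _ ?_⟩
    rw [hid1]; linarith [pow_le_pow_left₀ hr1 (show r ≤ s * (2 * ξ) + 1 by linarith) 2]
  -- t_1 ≤ t_2
  have h12 : r - 1 ≤ 1 - q := by nlinarith [sq_nonneg (r - q)]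
  refine ⟨?_, ?_, ?_, ?_, ?_, ?_⟩
  · intro h
    have hA : ξ * s ^ 2 + s - 1 ≤ 0 := key' _ (by rw [hid1]; linarith [pow_le_pow_left₀ (show 0 ≤ s * (2 * ξ) + 1 by linarith) (show _ ≤ r by linarith) 2])
    have hs1 : s ≤ 1 := by linarith [mul_nonneg hξ0.le (sq_nonneg s)]
    have hD : Dset2 ξ s = Set.Icc (-1) 1 := by
      rcases hs0.eq_or_lt with h0 | h0
      · subst h0
        ext p
        simp [Dset2, abs_le]
      · rw [aux_D ξ s h0, max_eq_left, min_eq_left]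
        · rw [le_sub_iff_add_le, le_div_iff₀ h0]; linarith
        · rw [aux_lo ξ s h0]; linarith [mul_nonneg hξ0.le (sq_nonneg s)]
    unfold omega2
    have h9 : ξ * s ≤ 1 / 4 := by linarith [mul_le_mul hξ hs1 hs0 (by norm_num)]
    have h10 : 0 ≤ ξ * s := by positivity
    rw [hD, aux_int_cross]
    · ring
    · linarith
    · linarith
  · intro h1 h2
    obtain ⟨h0, hA⟩ := hbig (by linarith)
    have hB : 0 ≤ ξ * s ^ 2 - s + 1 := key _ (by rw [hid2]; linarith [pow_le_pow_left₀ hq1 (show q ≤ 1 - s * (2 * ξ) by linarith) 2])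
    have hi := (aux_hi ξ s h0 1).2 (by linarith)
    have hlo := (aux_lo ξ s h0).2 hB
    unfold omega2
    rw [aux_D ξ s h0, max_eq_left hlo, min_eq_right hi, aux_int_cross]
    · field_simp
      ring
    · linarith
    · have : 0 < 1 / s := by positivity
      linarith [mul_nonneg hξ0.le hs0]
  · intro h1 h2
    obtain ⟨h0, hA⟩ := hbig (by linarith)
    have hC : ξ * s ^ 2 ≤ 1 := by rw [hid4]; exact pow_le_one₀ (by positivity) h2
    have hB : ξ * s ^ 2 - s + 1 ≤ 0 := by
      by_contra hh
      push Not at hh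
      have h5 : 0 < (s * (2 * ξ) - 1) ^ 2 - q ^ 2 := by rw [← hid2]; positivity
      have h6 : 1 + q < s * (2 * ξ) := by by_contra h8; linarith [sq_le_sq' (show -q ≤ s * (2 * ξ) - 1 by linarith) (by linarith)]
      linarith [mul_pos h0 (sub_pos.2 h6), mul_nonneg h0.le hq1, mul_nonneg h0.le (sub_nonneg.2 hξ)]
    have hi := (aux_hi ξ s h0 1).2 (by linarith)
    have hlo : -1 ≤ -(1 / s) - ξ * s := by
      by_contra hh
      push Not at hh
      have := (aux_lo ξ s h0).1 hh.le
      have h7 : ξ * s ^ 2 - s + 1 = 0 := le_antisymm hB this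
      have : (-(1 / s) - ξ * s) * s = -1 - ξ * s ^ 2 := by field_simp
      linarith [mul_lt_mul_of_pos_right hh h0]
    have hm : ξ * s ≤ 1 / s := by rw [le_div_iff₀ h0]; linarith
    unfold omega2
    rw [aux_D ξ s h0, max_eq_right hlo, min_eq_right hi, aux_int_cross]
    · field_simp
      ring
    · linarith
    · have : 0 < ξ * s := by positivity
      linarith
  · intro h1 h2
    have hC : 1 ≤ ξ * s ^ 2 := by rw [hid4]; exact one_le_pow₀ h1.le
    have h0 : 0 < s := by
      rcases hs0.eq_or_lt with h | h
      · subst h; norm_num at hC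
      · exact h
    have hB : ξ * s ^ 2 - s + 1 ≤ 0 := by
      by_contra hh
      push Not at hh
      have h5 : 0 < (s * (2 * ξ) - 1) ^ 2 - q ^ 2 := by rw [← hid2]; positivity
      have h6 : s * (2 * ξ) < 1 - q := by by_contra h8; linarith [sq_le_sq' (show -q ≤ s * (2 * ξ) - 1 by linarith) (by linarith)]
      linarith [pow_lt_pow_left₀ h6 hsx two_ne_zero, mul_nonneg hq1 (sub_nonneg.2 hq3), mul_nonneg hξ0.le (sub_nonneg.2 hC)]
    have hi := (aux_hi ξ s h0 1).2 (by linarith)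
    have hlo : -1 ≤ -(1 / s) - ξ * s := by
      by_contra hh
      push Not at hh
      have := (aux_lo ξ s h0).1 hh.le
      have h7 : ξ * s ^ 2 - s + 1 = 0 := le_antisymm hB this
      have : (-(1 / s) - ξ * s) * s = -1 - ξ * s ^ 2 := by field_simp
      linarith [mul_lt_mul_of_pos_right hh h0]
    have hm : 1 / s ≤ ξ * s := by rw [div_le_iff₀ h0]; linarith
    have hp : 0 < 1 / s := by positivity
    unfold omega2
    rw [aux_D ξ s h0, max_eq_right hlo, min_eq_right hi, aux_int_pos]
    · field_simp
      ring
    · linarith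
    · linarith
  · intro h1 h2
    obtain ⟨h0, hA⟩ := hbig (by linarith)
    have hB : 0 ≤ ξ * s ^ 2 - s + 1 := key _ (by rw [hid2]; linarith [pow_le_pow_left₀ hq1 (show q ≤ s * (2 * ξ) - 1 by linarith) 2])
    have hE : ξ * s ^ 2 - s - 1 ≤ 0 := key' _ (by rw [hid3]; linarith [sq_le_sq' (show -r ≤ s * (2 * ξ) - 1 by linarith) (by linarith)])
    have hi := (aux_hi ξ s h0 1).2 (by linarith)
    have hlo := (aux_lo ξ s h0).2 hB
    unfold omega2
    rw [aux_D ξ s h0, max_eq_left hlo, min_eq_right hi, aux_int_pos]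
    · field_simp
      ring
    · linarith
    · rw [le_sub_iff_add_le, le_div_iff₀ h0]; linarith
  · intro h1
    obtain ⟨h0, hA⟩ := hbig (by linarith)
    have hE : 0 < ξ * s ^ 2 - s - 1 := by
      by_contra hh
      push Not at hh
      have h5 : (s * (2 * ξ) - 1) ^ 2 - r ^ 2 ≤ 0 := by rw [← hid3]; linarith [mul_nonneg hξ0.le (neg_nonneg.2 hh)]
      linarith [pow_lt_pow_left₀ (show r < s * (2 * ξ) - 1 by linarith) hr1 two_ne_zero]
    have hD : Dset2 ξ s = ∅ := by
      ext p
      simp only [Dset2, Set.mem_ofPred_eq, abs_le, Set.mem_empty_iff_false, iff_false]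
      rintro ⟨⟨a, b⟩, c, d⟩
      linarith [mul_le_mul_of_nonneg_right a hs0]
    unfold omega2
    rw [hD]
    simp
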